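/- Fix real numbers A > 0, B, C with D := B^2 − 4AC > 0, and fix a closed interval [X,Y] with X > (−B + sqrt(D))/(2A). Then for every ε > 0, as Δ → ∞, the number of pairs (m,n) with n ≥ 1, gcd(m,n)=1, X ≤ m/n ≤ Y, and 0 < A·m^2 + B·m·n + C·n^2 ≤ Δ equals (3Δ/π^2)·(1/sqrt(D))·[ log( (t − (−B+sqrt(D))/(2A)) / (t − (−B−sqrt(D))/(2A)) ) ] evaluated from t = X to t = Y, plus an error O(Δ^{1/2+ε}). -/

import Mathlib

open Real

/-- The integer points of the dilate of `Ω` by the factor `s`. -/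
def dilatedPoints (Ω : Set (ℝ × ℝ)) (s : ℝ) : Set (ℤ × ℤ) :=
  {p | ((p.1 : ℝ) / s, (p.2 : ℝ) / s) ∈ Ω}

/-- The plane region between the graphs `x = v y` and `x = u y` over `0 < y ≤ K`. -/
def regionBetweenGraphs (v u : ℝ → ℝ) (K : ℝ) : Set (ℝ × ℝ) :=
  {p | 0 < p.2 ∧ p.2 ≤ K ∧ v p.2 ≤ p.1 ∧ p.1 ≤ u p.2}

theorem hasSum_moebius_div_sq :
    HasSum (fun n : ℕ => (ArithmeticFunction.moebius n : ℝ) / (n : ℝ) ^ 2) (6 / π ^ 2) := by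
  have h2 : 1 < (2 : ℂ).re := by norm_num
  have hs := (ArithmeticFunction.LSeriesSummable_moebius_iff.mpr h2).LSeriesHasSum
  have hval : LSeries (fun n => (ArithmeticFunction.moebius n : ℂ)) 2 = ((6 / π ^ 2 : ℝ) : ℂ) := by
    have h := ArithmeticFunction.LSeries_zeta_mul_Lseries_moebius h2
    rw [ArithmeticFunction.LSeries_zeta_eq_riemannZeta h2, riemannZeta_two] at h
    have hpi : (π : ℂ) ≠ 0 := by exact_mod_cast Real.pi_ne_zero
    push_cast
    field_simp at h ⊢
    linear_combination h
  rw [hval, LSeriesHasSum] at hs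
  rw [← Complex.hasSum_ofReal]
  convert hs using 1
  ext n
  rcases eq_or_ne n 0 with rfl | hn
  · simp
  · rw [LSeries.term_of_ne_zero hn]
    push_cast
    norm_num

theorem abs_sum_moebius_div_sq_sub_le {N : ℕ} (hN : N ≠ 0) :
    |(∑ d ∈ Finset.Icc 1 N, (ArithmeticFunction.moebius d : ℝ) / (d : ℝ) ^ 2) - 6 / π ^ 2| ≤
      (N : ℝ)⁻¹ := by
  have hlim := hasSum_moebius_div_sq.tendsto_sum_nat.comp (Filter.tendsto_add_atTop_nat 1)
  have hrange : ∀ M : ℕ,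
      ∑ d ∈ Finset.range (M + 1), (ArithmeticFunction.moebius d : ℝ) / (d : ℝ) ^ 2 =
        ∑ d ∈ Finset.Icc 1 M, (ArithmeticFunction.moebius d : ℝ) / (d : ℝ) ^ 2 := by
    intro M
    rw [Finset.range_eq_Ico, Finset.sum_eq_sum_Ico_succ_bot (Nat.succ_pos M)]
    simp [← Finset.Ico_succ_right_eq_Icc]
  refine le_of_tendsto ((tendsto_const_nhds.sub hlim).abs)
    (Filter.eventually_atTop.mpr ⟨N, fun M hM => ?_⟩)
  simp only [Function.comp_apply]
  rw [hrange, abs_sub_comm]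
  have hsplit : Finset.Icc 1 M = Finset.Icc 1 N ∪ Finset.Ioc N M := by
    ext d
    simp only [Finset.mem_Icc, Finset.mem_union, Finset.mem_Ioc]
    omega
  have hdisj : Disjoint (Finset.Icc 1 N) (Finset.Ioc N M) := by
    rw [Finset.disjoint_left]
    intro d hd hd'
    simp only [Finset.mem_Icc, Finset.mem_Ioc] at hd hd'
    omega
  rw [hsplit, Finset.sum_union hdisj, add_sub_cancel_left]
  calc _ ≤ ∑ d ∈ Finset.Ioc N M, |(ArithmeticFunction.moebius d : ℝ) / (d : ℝ) ^ 2| :=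
        Finset.abs_sum_le_sum_abs _ _
    _ ≤ ∑ d ∈ Finset.Ioc N M, ((d : ℝ) ^ 2)⁻¹ := by
        refine Finset.sum_le_sum fun d _ => ?_
        rw [abs_div, abs_of_nonneg (sq_nonneg (d : ℝ)), div_eq_mul_inv]
        refine mul_le_of_le_one_left (by positivity) ?_
        exact_mod_cast ArithmeticFunction.abs_moebius_le_one (n := d)
    _ ≤ (N : ℝ)⁻¹ - (M : ℝ)⁻¹ := sum_Ioc_inv_sq_le_sub hN hM
    _ ≤ (N : ℝ)⁻¹ := by linarith [inv_nonneg.mpr (Nat.cast_nonneg (α := ℝ) M)]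

theorem abs_card_Icc_ceil_floor_sub_le (a b : ℝ) :
    |((Finset.Icc ⌈a⌉ ⌊b⌋).card : ℝ) - max (b - a) 0| ≤ 1 := by
  have ha := Int.le_ceil a
  have ha' := Int.ceil_lt_add_one a
  have hb := Int.floor_le b
  have hb' := Int.lt_floor_add_one b
  rw [Int.card_Icc, abs_le]
  rcases le_or_gt ⌈a⌉ (⌊b⌋ + 1) with h | h
  · have hcast : (((⌊b⌋ + 1 - ⌈a⌉).toNat : ℕ) : ℝ) = (⌊b⌋ : ℝ) + 1 - ⌈a⌉ := by
      have h' : (((⌊b⌋ + 1 - ⌈a⌉).toNat : ℕ) : ℤ) = ⌊b⌋ + 1 - ⌈a⌉ := Int.toNat_of_nonneg (by omega)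
      exact_mod_cast h'
    have hnn : (0 : ℝ) ≤ (⌊b⌋ : ℝ) + 1 - ⌈a⌉ := by rw [← hcast]; positivity
    rw [hcast]
    constructor
    · rcases max_cases (b - a) 0 with ⟨h1, _⟩ | ⟨h1, _⟩ <;> rw [h1] <;> linarith
    · linarith [le_max_left (b - a) 0]
  · have h0 : (⌊b⌋ + 1 - ⌈a⌉).toNat = 0 := by omega
    have h' : (⌊b⌋ : ℝ) + 1 + 1 ≤ ⌈a⌉ := by exact_mod_cast h
    rw [h0, max_eq_right (by linarith)]
    norm_num

theorem abs_sum_sub_integral_le_of_lipschitz {f : ℝ → ℝ} {L : NNReal} (hf : LipschitzWith L f)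
    {K s : ℝ} (hK : 0 ≤ K) (hs : 0 < s) :
    |∑ k ∈ Finset.range ⌊K * s⌋₊, f ((k + 1 : ℕ) / s) - s * ∫ y in (0 : ℝ)..K, f y| ≤
      |f 0| + 2 * (L * K) := by
  set N := ⌊K * s⌋₊ with hN
  have hNle : (N : ℝ) ≤ K * s := Nat.floor_le (by positivity)
  have hNlt : K * s < N + 1 := Nat.lt_floor_add_one _
  have hint : ∀ a b : ℝ, IntervalIntegrable f MeasureTheory.volume a b :=
    fun a b => hf.continuous.intervalIntegrable a b
  have hsplit : ∫ y in (0 : ℝ)..K, f y =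
      (∑ k ∈ Finset.range N, ∫ y in ((k : ℕ) / s : ℝ)..((k + 1 : ℕ) / s), f y) +
        ∫ y in (N / s : ℝ)..K, f y := by
    rw [intervalIntegral.sum_integral_adjacent_intervals (a := fun k : ℕ => (k : ℝ) / s)
      (fun k _ => hint _ _)]
    simp only [Nat.cast_zero, zero_div]
    rw [intervalIntegral.integral_add_adjacent_intervals (hint _ _) (hint _ _)]
  have hcell : ∀ k ∈ Finset.range N,
      |f ((k + 1 : ℕ) / s) - s * ∫ y in ((k : ℕ) / s : ℝ)..((k + 1 : ℕ) / s), f y| ≤ L / s := by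
    intro k _
    have hlen : ((k + 1 : ℕ) / s : ℝ) - (k : ℕ) / s = 1 / s := by
      push_cast
      ring
    have heq : f ((k + 1 : ℕ) / s) - s * ∫ y in ((k : ℕ) / s : ℝ)..((k + 1 : ℕ) / s), f y =
        s * ∫ y in ((k : ℕ) / s : ℝ)..((k + 1 : ℕ) / s), (f ((k + 1 : ℕ) / s) - f y) := by
      rw [intervalIntegral.integral_sub (by simp) (hint _ _),
        intervalIntegral.integral_const, hlen, smul_eq_mul]
      field_simp
    have hle : ((k : ℕ) / s : ℝ) ≤ (k + 1 : ℕ) / s := by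
      have : 0 < 1 / s := by positivity
      linarith
    have hbound := intervalIntegral.norm_integral_le_of_norm_le_const
      (a := ((k : ℕ) / s : ℝ)) (b := (k + 1 : ℕ) / s) (C := L * (1 / s))
      (f := fun y => f ((k + 1 : ℕ) / s) - f y) (fun y hy => by
        rw [Set.uIoc_of_le hle] at hy
        refine (hf.norm_sub_le _ _).trans (mul_le_mul_of_nonneg_left ?_ L.coe_nonneg)
        rw [Real.norm_eq_abs, abs_of_nonneg (by linarith [hy.2])]
        linarith [hy.1])
    rw [hlen, abs_of_pos (by positivity : 0 < 1 / s), Real.norm_eq_abs] at hbound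
    rw [heq, abs_mul, abs_of_pos hs]
    calc _ ≤ s * (L * (1 / s) * (1 / s)) := mul_le_mul_of_nonneg_left hbound hs.le
      _ = L / s := by field_simp
  have hNK : (N / s : ℝ) ≤ K := (div_le_iff₀ hs).mpr hNle
  have hrest : |s * ∫ y in (N / s : ℝ)..K, f y| ≤ |f 0| + L * K := by
    have hbound := intervalIntegral.norm_integral_le_of_norm_le_const
      (a := (N / s : ℝ)) (b := K) (C := |f 0| + L * K) (f := f) (fun y hy => by
        rw [Set.uIoc_of_le hNK] at hy
        have hy0 : 0 ≤ y := le_trans (by positivity) hy.1.le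
        have h := hf.norm_sub_le y 0
        rw [sub_zero, Real.norm_eq_abs, Real.norm_eq_abs, abs_of_nonneg hy0] at h
        have h' := mul_le_mul_of_nonneg_left hy.2 L.coe_nonneg
        have h'' := abs_sub_abs_le_abs_sub (f y) (f 0)
        rw [Real.norm_eq_abs]
        linarith)
    rw [abs_of_nonneg (sub_nonneg.mpr hNK), Real.norm_eq_abs] at hbound
    rw [abs_mul, abs_of_pos hs]
    have hC : 0 ≤ |f 0| + L * K := by positivity
    have hs1 : s * (K - N / s) ≤ 1 := by
      rw [mul_sub, mul_div_cancel₀ _ hs.ne']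
      linarith
    calc _ ≤ s * ((|f 0| + L * K) * (K - N / s)) := mul_le_mul_of_nonneg_left hbound hs.le
      _ = (|f 0| + L * K) * (s * (K - N / s)) := by ring
      _ ≤ (|f 0| + L * K) * 1 := mul_le_mul_of_nonneg_left hs1 hC
      _ = _ := mul_one _
  have hsum : |∑ k ∈ Finset.range N, (f ((k + 1 : ℕ) / s) -
      s * ∫ y in ((k : ℕ) / s : ℝ)..((k + 1 : ℕ) / s), f y)| ≤ L * K := by
    calc _ ≤ ∑ k ∈ Finset.range N, (L / s : ℝ) :=
          (Finset.abs_sum_le_sum_abs _ _).trans (Finset.sum_le_sum hcell)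
      _ = L * (N / s) := by
          rw [Finset.sum_const, Finset.card_range, nsmul_eq_mul]
          ring
      _ ≤ L * K := mul_le_mul_of_nonneg_left hNK L.coe_nonneg
  rw [Finset.sum_sub_distrib, ← Finset.mul_sum] at hsum
  rw [hsplit, mul_add, ← sub_sub]
  refine (abs_sub _ _).trans ?_
  linarith

theorem dilatedPoints_regionBetweenGraphs (v u : ℝ → ℝ) {K s : ℝ} (hK : 0 ≤ K) (hs : 0 < s) :
    dilatedPoints (regionBetweenGraphs v u K) s =
      (((Finset.range ⌊K * s⌋₊).sigma fun k : ℕ =>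
        Finset.Icc ⌈s * v ((k + 1 : ℕ) / s)⌉ ⌊s * u ((k + 1 : ℕ) / s)⌋).image
          fun q => (q.2, ((q.1 + 1 : ℕ) : ℤ)) : Finset (ℤ × ℤ)) := by
  ext ⟨m, n⟩
  simp only [dilatedPoints, regionBetweenGraphs, Set.mem_ofPred_eq, Finset.coe_image, Set.mem_image,
    Finset.mem_coe, Finset.mem_sigma, Finset.mem_range, Finset.mem_Icc, Int.ceil_le, Int.le_floor,
    Prod.mk.injEq, Sigma.exists]
  have hfib : ∀ y : ℝ, (v y ≤ m / s ∧ m / s ≤ u y) ↔ (s * v y ≤ m ∧ (m : ℝ) ≤ s * u y) := by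
    intro y
    rw [le_div_iff₀ hs, div_le_iff₀ hs, mul_comm (v y), mul_comm (u y)]
  constructor
  · rintro ⟨hn, hnK, hm⟩
    have hn0 : 0 < n := by
      have h := (div_pos_iff_of_pos_right hs).mp hn
      exact_mod_cast h
    obtain ⟨k, rfl⟩ : ∃ k : ℕ, n = ((k + 1 : ℕ) : ℤ) := ⟨(n - 1).toNat, by omega⟩
    refine ⟨k, m, ⟨?_, ?_⟩, rfl, rfl⟩
    · rw [← Nat.succ_le_iff, Nat.le_floor_iff (by positivity)]
      have h := (div_le_iff₀ hs).mp hnK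
      exact_mod_cast h
    · have h := (hfib _).mp hm
      exact_mod_cast h
  · rintro ⟨k, m', ⟨hk, hm⟩, rfl, rfl⟩
    rw [← Nat.succ_le_iff, Nat.le_floor_iff (by positivity)] at hk
    refine ⟨?_, ?_, ?_⟩
    · push_cast
      positivity
    · rw [div_le_iff₀ hs]
      exact_mod_cast hk
    · refine (hfib _).mpr ?_
      exact_mod_cast hm

theorem finite_dilatedPoints_regionBetweenGraphs (v u : ℝ → ℝ) {K s : ℝ} (hK : 0 ≤ K)
    (hs : 0 < s) : (dilatedPoints (regionBetweenGraphs v u K) s).Finite := by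
  rw [dilatedPoints_regionBetweenGraphs v u hK hs]
  exact Finset.finite_toSet _

theorem abs_ncard_dilatedPoints_sub_le {v u : ℝ → ℝ} {Lv Lu : NNReal} (hv : LipschitzWith Lv v)
    (hu : LipschitzWith Lu u) {K : ℝ} (hK : 0 ≤ K) :
    ∃ c : ℝ, 0 ≤ c ∧ ∀ s : ℝ, 0 < s →
      |((dilatedPoints (regionBetweenGraphs v u K) s).ncard : ℝ) -
        s ^ 2 * ∫ y in (0 : ℝ)..K, max (u y - v y) 0| ≤ c * s := by
  have hf : LipschitzWith (Lu + Lv) fun y => max (u y - v y) 0 := (hu.sub hv).max_const 0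
  refine ⟨K + (|max (u 0 - v 0) 0| + 2 * ((Lu + Lv : NNReal) * K)), by positivity, fun s hs => ?_⟩
  have hcard : ((dilatedPoints (regionBetweenGraphs v u K) s).ncard : ℝ) =
      ∑ k ∈ Finset.range ⌊K * s⌋₊,
        ((Finset.Icc ⌈s * v ((k + 1 : ℕ) / s)⌉ ⌊s * u ((k + 1 : ℕ) / s)⌋).card : ℝ) := by
    rw [dilatedPoints_regionBetweenGraphs v u hK hs, Set.ncard_coe_finset,
      Finset.card_image_of_injective, Finset.card_sigma, Nat.cast_sum]
    rintro ⟨k, m⟩ ⟨k', m'⟩ h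
    simp only [Prod.mk.injEq] at h
    obtain ⟨rfl, h⟩ := h
    obtain rfl : k = k' := by omega
    rfl
  have hfib : ∀ k ∈ Finset.range ⌊K * s⌋₊,
      |((Finset.Icc ⌈s * v ((k + 1 : ℕ) / s)⌉ ⌊s * u ((k + 1 : ℕ) / s)⌋).card : ℝ) -
        s * max (u ((k + 1 : ℕ) / s) - v ((k + 1 : ℕ) / s)) 0| ≤ 1 := by
    intro k _
    have h := abs_card_Icc_ceil_floor_sub_le (s * v ((k + 1 : ℕ) / s)) (s * u ((k + 1 : ℕ) / s))
    rwa [← mul_sub, ← mul_zero s, ← mul_max_of_nonneg _ _ hs.le] at h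
  have hsum := (Finset.abs_sum_le_sum_abs _ _).trans (Finset.sum_le_sum hfib)
  rw [Finset.sum_sub_distrib, ← hcard, Finset.sum_const, Finset.card_range, nsmul_eq_mul, mul_one,
    ← Finset.mul_sum] at hsum
  have hR := mul_le_mul_of_nonneg_left (abs_sum_sub_integral_le_of_lipschitz hf hK hs) hs.le
  nth_rewrite 1 [← abs_of_pos hs] at hR
  rw [← abs_mul, mul_sub, ← mul_assoc, ← sq] at hR
  have hfl : (⌊K * s⌋₊ : ℝ) ≤ K * s := Nat.floor_le (by positivity)
  refine (abs_sub_le _ _ _).trans ((add_le_add hsum hR).trans ?_)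
  linarith

theorem sum_moebius_Icc_dvd_eq_ite {N : ℕ} {m n : ℤ} (hn : 0 < n) (hnN : n ≤ N) :
    ∑ d ∈ Finset.Icc 1 N, (if (d : ℤ) ∣ m ∧ (d : ℤ) ∣ n then ArithmeticFunction.moebius d else 0) =
      if Int.gcd m n = 1 then 1 else 0 := by
  have hg : Int.gcd m n ≠ 0 := by
    rw [Ne, Int.gcd_eq_zero_iff]
    omega
  have hdiv : (Finset.Icc 1 N).filter (fun d : ℕ => (d : ℤ) ∣ m ∧ (d : ℤ) ∣ n) =
      (Int.gcd m n).divisors := by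
    ext d
    rw [Finset.mem_filter, Finset.mem_Icc, Nat.mem_divisors, Int.dvd_gcd_iff]
    constructor
    · exact fun h => ⟨h.2, hg⟩
    · rintro ⟨h, -⟩
      have hle := Int.le_of_dvd hn h.2
      have hd : d ≠ 0 := by
        rintro rfl
        have := h.2
        simp only [Nat.cast_zero, zero_dvd_iff] at this
        omega
      exact ⟨by omega, h⟩
  rw [← Finset.sum_filter, hdiv, ← ArithmeticFunction.coe_mul_zeta_apply,
    ArithmeticFunction.moebius_mul_coe_zeta, ArithmeticFunction.one_apply]

theorem ncard_dvd_dilatedPoints (Ω : Set (ℝ × ℝ)) (s : ℝ) {d : ℕ} (hd : d ≠ 0) :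
    {p ∈ dilatedPoints Ω s | (d : ℤ) ∣ p.1 ∧ (d : ℤ) ∣ p.2}.ncard =
      (dilatedPoints Ω (s / d)).ncard := by
  have hd' : (d : ℤ) ≠ 0 := by exact_mod_cast hd
  have hcast : ∀ a : ℤ, (((d : ℤ) * a : ℤ) : ℝ) / s = a / (s / d) := by
    intro a
    push_cast
    rw [div_div_eq_mul_div, mul_comm]
  have hinj : Function.Injective fun p : ℤ × ℤ => ((d : ℤ) * p.1, (d : ℤ) * p.2) := by
    rintro ⟨a, b⟩ ⟨a', b'⟩ h
    simp only [Prod.mk.injEq] at h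
    rw [mul_left_cancel₀ hd' h.1, mul_left_cancel₀ hd' h.2]
  rw [← Set.ncard_image_of_injective (dilatedPoints Ω (s / d)) hinj]
  congr 1
  ext ⟨m, n⟩
  simp only [dilatedPoints, Set.mem_ofPred_eq, Set.mem_image, Prod.mk.injEq, Prod.exists]
  constructor
  · rintro ⟨h, ha, hb⟩
    obtain ⟨a, rfl⟩ := ha
    obtain ⟨b, rfl⟩ := hb
    rw [hcast, hcast] at h
    exact ⟨a, b, h, rfl, rfl⟩
  · rintro ⟨a, b, h, rfl, rfl⟩
    rw [hcast, hcast]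
    exact ⟨h, dvd_mul_right _ _, dvd_mul_right _ _⟩

theorem ncard_coprime_dilatedPoints {Ω : Set (ℝ × ℝ)} {K s : ℝ}
    (hΩ : ∀ p ∈ Ω, 0 < p.2 ∧ p.2 ≤ K) (hs : 0 < s) (hfin : (dilatedPoints Ω s).Finite) :
    ({p ∈ dilatedPoints Ω s | Int.gcd p.1 p.2 = 1}.ncard : ℤ) =
      ∑ d ∈ Finset.Icc 1 ⌈K * s⌉₊,
        ArithmeticFunction.moebius d * ((dilatedPoints Ω (s / d)).ncard : ℤ) := by
  classical
  obtain ⟨F, hF⟩ := hfin.exists_finset_coe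
  have hsep : ∀ P : ℤ × ℤ → Prop,
      {p ∈ dilatedPoints Ω s | P p}.ncard = (F.filter P).card := by
    intro P
    rw [← hF, ← Set.ncard_coe_finset, Finset.coe_filter]
    rfl
  have hbound : ∀ p ∈ F, 0 < p.2 ∧ p.2 ≤ ⌈K * s⌉₊ := by
    intro p hp
    have hp' : p ∈ dilatedPoints Ω s := by
      rw [← hF]
      exact hp
    obtain ⟨h0, hK⟩ := hΩ _ hp'
    have h0' := (div_pos_iff_of_pos_right hs).mp h0
    have hK' := ((div_le_iff₀ hs).mp hK).trans (Nat.le_ceil _)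
    exact ⟨by exact_mod_cast h0', by exact_mod_cast hK'⟩
  calc _ = ∑ p ∈ F, (if Int.gcd p.1 p.2 = 1 then (1 : ℤ) else 0) := by
        rw [hsep, Finset.card_filter]
        push_cast
        rfl
    _ = ∑ p ∈ F, ∑ d ∈ Finset.Icc 1 ⌈K * s⌉₊,
          (if (d : ℤ) ∣ p.1 ∧ (d : ℤ) ∣ p.2 then ArithmeticFunction.moebius d else 0) :=
        Finset.sum_congr rfl fun p hp =>
          (sum_moebius_Icc_dvd_eq_ite (hbound p hp).1 (hbound p hp).2).symm
    _ = _ := by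
        rw [Finset.sum_comm]
        refine Finset.sum_congr rfl fun d hd => ?_
        rw [← ncard_dvd_dilatedPoints Ω s (by have := (Finset.mem_Icc.mp hd).1; omega), hsep,
          ← Finset.sum_filter, Finset.sum_const, nsmul_eq_mul, mul_comm]
        congr!

theorem abs_ncard_coprime_dilatedPoints_sub_le {Ω : Set (ℝ × ℝ)} {K κ c : ℝ} (hK : 0 < K)
    (hc : 0 ≤ c) (hΩ : ∀ p ∈ Ω, 0 < p.2 ∧ p.2 ≤ K)
    (hfin : ∀ s : ℝ, 0 < s → (dilatedPoints Ω s).Finite)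
    (hcount : ∀ s : ℝ, 0 < s → |((dilatedPoints Ω s).ncard : ℝ) - s ^ 2 * κ| ≤ c * s)
    {s : ℝ} (hs : 0 < s) :
    |({p ∈ dilatedPoints Ω s | Int.gcd p.1 p.2 = 1}.ncard : ℝ) - 6 / π ^ 2 * κ * s ^ 2| ≤
      c * s * (1 + Real.log ⌈K * s⌉₊) + |κ| * s / K := by
  have hident := ncard_coprime_dilatedPoints hΩ hs (hfin s hs)
  set N := ⌈K * s⌉₊ with hN
  have hN0 : N ≠ 0 := (Nat.ceil_pos.mpr (by positivity)).ne'
  have hNle : K * s ≤ N := Nat.le_ceil _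
  have hident' : ({p ∈ dilatedPoints Ω s | Int.gcd p.1 p.2 = 1}.ncard : ℝ) =
      ∑ d ∈ Finset.Icc 1 N,
        (ArithmeticFunction.moebius d : ℝ) * ((dilatedPoints Ω (s / d)).ncard : ℝ) := by
    exact_mod_cast congrArg (Int.cast : ℤ → ℝ) hident
  have hterm : ∀ d ∈ Finset.Icc 1 N,
      |(ArithmeticFunction.moebius d : ℝ) * ((dilatedPoints Ω (s / d)).ncard : ℝ) -
        s ^ 2 * κ * ((ArithmeticFunction.moebius d : ℝ) / (d : ℝ) ^ 2)| ≤ c * s * (d : ℝ)⁻¹ := by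
    intro d hd
    have hd0 : (0 : ℝ) < d := by exact_mod_cast (Finset.mem_Icc.mp hd).1
    have hμ : |(ArithmeticFunction.moebius d : ℝ)| ≤ 1 := by
      exact_mod_cast ArithmeticFunction.abs_moebius_le_one (n := d)
    have heq : (ArithmeticFunction.moebius d : ℝ) * ((dilatedPoints Ω (s / d)).ncard : ℝ) -
        s ^ 2 * κ * ((ArithmeticFunction.moebius d : ℝ) / (d : ℝ) ^ 2) =
        ArithmeticFunction.moebius d *
          (((dilatedPoints Ω (s / d)).ncard : ℝ) - (s / d) ^ 2 * κ) := by
      field_simp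
    rw [heq, abs_mul]
    refine (mul_le_of_le_one_left (abs_nonneg _) hμ).trans ((hcount _ (by positivity)).trans ?_)
    rw [div_eq_mul_inv, mul_assoc]
  have hsum := (Finset.abs_sum_le_sum_abs _ _).trans (Finset.sum_le_sum hterm)
  rw [Finset.sum_sub_distrib, ← hident', ← Finset.mul_sum, ← Finset.mul_sum] at hsum
  have hharm : ∑ d ∈ Finset.Icc 1 N, (d : ℝ)⁻¹ ≤ 1 + Real.log N := by
    have h := harmonic_le_one_add_log N
    rw [harmonic_eq_sum_Icc] at h
    push_cast at h
    exact h
  have htail : |s ^ 2 * κ * (∑ d ∈ Finset.Icc 1 N,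
      (ArithmeticFunction.moebius d : ℝ) / (d : ℝ) ^ 2) - 6 / π ^ 2 * κ * s ^ 2| ≤
        |κ| * s / K := by
    rw [show ∀ t : ℝ, s ^ 2 * κ * t - 6 / π ^ 2 * κ * s ^ 2 = s ^ 2 * κ * (t - 6 / π ^ 2) from
      fun t => by ring, abs_mul, abs_mul, abs_of_nonneg (sq_nonneg s)]
    calc _ ≤ s ^ 2 * |κ| * (N : ℝ)⁻¹ :=
          mul_le_mul_of_nonneg_left (abs_sum_moebius_div_sq_sub_le hN0) (by positivity)
      _ ≤ s ^ 2 * |κ| * (K * s)⁻¹ := by gcongr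
      _ = |κ| * s / K := by field_simp
  refine (abs_sub_le _ _ _).trans (add_le_add (hsum.trans ?_) htail)
  exact mul_le_mul_of_nonneg_left hharm (by positivity)

/-- The larger solution `x` of `A x² + B x y + C y² = 1`, in terms of `D = B² - 4 A C`. -/
noncomputable def hyperbolaBranch (A B D y : ℝ) : ℝ :=
  (-B * y + √(D * y ^ 2 + 4 * A)) / (2 * A)

/-- An antiderivative of `1 / (A t² + B t + C)`, in terms of `D = B² - 4 A C`. -/
noncomputable def logQuotient (A B D t : ℝ) : ℝ :=
  1 / √D * Real.log ((t - (-B + √D) / (2 * A)) / (t - (-B - √D) / (2 * A)))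

section Hyperbola

variable {A B C D : ℝ}

theorem sqrt_lt_of_root_lt (hA : 0 < A) {t : ℝ} (ht : (-B + √D) / (2 * A) < t) :
    √D < 2 * A * t + B := by
  rw [div_lt_iff₀ (by positivity)] at ht
  linarith

theorem quadratic_pos_of_root_lt (hA : 0 < A) (hDdef : D = B ^ 2 - 4 * A * C) (hD : 0 < D) {t : ℝ}
    (ht : (-B + √D) / (2 * A) < t) : 0 < A * t ^ 2 + B * t + C := by
  have h := sqrt_lt_of_root_lt hA ht
  have h' : D < (2 * A * t + B) ^ 2 := (Real.sqrt_lt' ((Real.sqrt_pos.mpr hD).trans h)).mp h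
  have h4 : 0 < 4 * A * (A * t ^ 2 + B * t + C) := by rw [hDdef] at h'; linarith
  exact pos_of_mul_pos_right h4 (by positivity)

theorem le_hyperbolaBranch_iff (hA : 0 < A) (hDdef : D = B ^ 2 - 4 * A * C) (hD : 0 < D)
    {x y : ℝ} (hxy : 0 ≤ 2 * A * x + B * y) :
    x ≤ hyperbolaBranch A B D y ↔ A * x ^ 2 + B * x * y + C * y ^ 2 ≤ 1 := by
  rw [hyperbolaBranch, le_div_iff₀ (by positivity)]
  have h : x * (2 * A) ≤ -B * y + √(D * y ^ 2 + 4 * A) ↔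
      2 * A * x + B * y ≤ √(D * y ^ 2 + 4 * A) := by
    constructor <;> intro h <;> linarith
  have hdiff : D * y ^ 2 + 4 * A - (2 * A * x + B * y) ^ 2 =
      4 * A * (1 - (A * x ^ 2 + B * x * y + C * y ^ 2)) := by
    rw [hDdef]
    ring
  rw [h, Real.le_sqrt hxy (by positivity), ← sub_nonneg, hdiff,
    mul_nonneg_iff_of_pos_left (by positivity), sub_nonneg]

theorem mul_le_hyperbolaBranch_iff (hA : 0 < A) (hDdef : D = B ^ 2 - 4 * A * C) (hD : 0 < D)
    {t y : ℝ} (ht : (-B + √D) / (2 * A) < t) (hy : 0 ≤ y) :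
    t * y ≤ hyperbolaBranch A B D y ↔ y ≤ 1 / √(A * t ^ 2 + B * t + C) := by
  have hq := quadratic_pos_of_root_lt hA hDdef hD ht
  have hlin := (Real.sqrt_nonneg D).trans (sqrt_lt_of_root_lt hA ht).le
  rw [le_hyperbolaBranch_iff hA hDdef hD (by linarith [mul_nonneg hlin hy]),
    le_div_iff₀ (Real.sqrt_pos.mpr hq), ← abs_of_nonneg (mul_nonneg hy (Real.sqrt_nonneg _)),
    ← sq_le_one_iff_abs_le_one, mul_pow y, Real.sq_sqrt hq.le]
  ring_nf

theorem hyperbolaBranch_eq_mul (hA : 0 < A) (hDdef : D = B ^ 2 - 4 * A * C) {t y : ℝ}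
    (ht : (-B + √D) / (2 * A) < t) (hy : 0 ≤ y) (h : (A * t ^ 2 + B * t + C) * y ^ 2 = 1) :
    hyperbolaBranch A B D y = t * y := by
  have hlin := (Real.sqrt_nonneg D).trans (sqrt_lt_of_root_lt hA ht).le
  have hsq : D * y ^ 2 + 4 * A = ((2 * A * t + B) * y) ^ 2 := by
    rw [hDdef]
    linear_combination (-4 * A) * h
  rw [hyperbolaBranch, hsq, Real.sqrt_sq (mul_nonneg hlin hy)]
  field_simp
  ring

theorem hasDerivAt_hyperbolaBranch (hA : 0 < A) (hD : 0 < D) (y : ℝ) :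
    HasDerivAt (hyperbolaBranch A B D) ((-B + D * y / √(D * y ^ 2 + 4 * A)) / (2 * A)) y := by
  have hpos : 0 < D * y ^ 2 + 4 * A := by positivity
  have h1 : HasDerivAt (fun y : ℝ => D * y ^ 2 + 4 * A) (D * (2 * y)) y := by
    simpa using ((hasDerivAt_pow 2 y).const_mul D).add_const (4 * A)
  have h2 := ((((hasDerivAt_id y).const_mul (-B)).add (h1.sqrt hpos.ne')).div_const (2 * A))
  refine h2.congr_deriv ?_
  field_simp

theorem lipschitzWith_hyperbolaBranch (hA : 0 < A) (hD : 0 < D) :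
    LipschitzWith ((|B| + √D) / (2 * A)).toNNReal (hyperbolaBranch A B D) := by
  refine lipschitzWith_of_nnnorm_deriv_le
    (fun y => (hasDerivAt_hyperbolaBranch hA hD y).differentiableAt) fun y => ?_
  have hpos : 0 < D * y ^ 2 + 4 * A := by positivity
  rw [(hasDerivAt_hyperbolaBranch hA hD y).deriv, ← NNReal.coe_le_coe, coe_nnnorm,
    Real.coe_toNNReal _ (by positivity), Real.norm_eq_abs, abs_div,
    abs_of_pos (by positivity : 0 < 2 * A)]
  refine div_le_div_of_nonneg_right ?_ (by positivity)
  refine (abs_add_le _ _).trans ?_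
  rw [abs_neg, abs_div, abs_of_pos (Real.sqrt_pos.mpr hpos)]
  refine add_le_add le_rfl ((div_le_iff₀ (Real.sqrt_pos.mpr hpos)).mpr ?_)
  rw [← Real.sqrt_mul hD.le]
  refine Real.abs_le_sqrt ?_
  nlinarith [mul_pos hD hA]

theorem hasDerivAt_logQuotient (hA : 0 < A) (hDdef : D = B ^ 2 - 4 * A * C) (hD : 0 < D) {t : ℝ}
    (ht : (-B + √D) / (2 * A) < t) :
    HasDerivAt (logQuotient A B D) (1 / (A * t ^ 2 + B * t + C)) t := by
  have hsq : 0 < √D := Real.sqrt_pos.mpr hD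
  have hsub : (-B + √D) / (2 * A) - (-B - √D) / (2 * A) = √D / A := by
    field_simp
    ring
  have hgap : 0 < √D / A := by positivity
  have h1 : 0 < t - (-B + √D) / (2 * A) := sub_pos.mpr ht
  have h2 : 0 < t - (-B - √D) / (2 * A) := by linarith
  have hfac : A * t ^ 2 + B * t + C =
      A * ((t - (-B + √D) / (2 * A)) * (t - (-B - √D) / (2 * A))) := by
    have hs := Real.sq_sqrt hD.le
    field_simp
    linear_combination hs + hDdef
  have hd := (((((hasDerivAt_id t).sub_const ((-B + √D) / (2 * A))).div
    ((hasDerivAt_id t).sub_const ((-B - √D) / (2 * A))) h2.ne').log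
      (div_pos h1 h2).ne').const_mul (1 / √D))
  refine hd.congr_deriv ?_
  rw [hfac]
  simp only [id, one_mul, mul_one, Pi.div_apply]
  rw [show t - (-B - √D) / (2 * A) - (t - (-B + √D) / (2 * A)) = √D / A by linarith]
  field_simp

theorem hasDerivAt_hyperbolaBranch_antiderivative (hA : 0 < A) (hDdef : D = B ^ 2 - 4 * A * C)
    (hD : 0 < D) {y : ℝ} (hy : 0 < y) :
    HasDerivAt (fun y => y * hyperbolaBranch A B D y / 2 -
      logQuotient A B D (hyperbolaBranch A B D y / y) / 2) (hyperbolaBranch A B D y) y := by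
  have hpos : 0 < D * y ^ 2 + 4 * A := by positivity
  have hroot : (-B + √D) / (2 * A) < hyperbolaBranch A B D y / y := by
    rw [hyperbolaBranch, lt_div_iff₀ hy, div_mul_eq_mul_div]
    refine div_lt_div_of_pos_right ?_ (by positivity)
    have h : √D * y < √(D * y ^ 2 + 4 * A) := by
      refine Real.lt_sqrt_of_sq_lt ?_
      rw [mul_pow, Real.sq_sqrt hD.le]
      linarith
    linarith
  have hone :
      A * hyperbolaBranch A B D y ^ 2 + B * hyperbolaBranch A B D y * y + C * y ^ 2 = 1 := by
    have hs := Real.sq_sqrt hpos.le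
    rw [hyperbolaBranch]
    generalize √(D * y ^ 2 + 4 * A) = S at hs ⊢
    field_simp
    linear_combination hs + y ^ 2 * hDdef
  have hq : A * (hyperbolaBranch A B D y / y) ^ 2 + B * (hyperbolaBranch A B D y / y) + C =
      1 / y ^ 2 := by
    field_simp
    linear_combination hone
  have hg := hasDerivAt_hyperbolaBranch (B := B) hA hD y
  have hL := hasDerivAt_logQuotient hA hDdef hD hroot
  rw [hq] at hL
  have hcomp := hL.comp (h := fun y => hyperbolaBranch A B D y / y) y
    (hg.div (hasDerivAt_id y) hy.ne')
  have h := (((hasDerivAt_id y).mul hg).div_const 2).sub (hcomp.div_const 2)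
  refine h.congr_deriv ?_
  simp only [id]
  field_simp
  ring

theorem integral_sector_length (hA : 0 < A) (hDdef : D = B ^ 2 - 4 * A * C) (hD : 0 < D)
    {X Y : ℝ} (hX : (-B + √D) / (2 * A) < X) (hXY : X ≤ Y) :
    ∫ y in (0 : ℝ)..1 / √(A * X ^ 2 + B * X + C),
        max (min (Y * y) (hyperbolaBranch A B D y) - X * y) 0 =
      (logQuotient A B D Y - logQuotient A B D X) / 2 := by
  have hY := hX.trans_le hXY
  have hqX := quadratic_pos_of_root_lt hA hDdef hD hX
  have hqY := quadratic_pos_of_root_lt hA hDdef hD hY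
  have hqXY : A * X ^ 2 + B * X + C ≤ A * Y ^ 2 + B * Y + C := by
    have h := (Real.sqrt_nonneg D).trans (sqrt_lt_of_root_lt hA hX).le
    nlinarith [mul_nonneg (sub_nonneg.mpr hXY) h, mul_nonneg hA.le (sq_nonneg (Y - X))]
  set a := 1 / √(A * Y ^ 2 + B * Y + C) with ha
  set b := 1 / √(A * X ^ 2 + B * X + C) with hb
  have ha0 : 0 < a := one_div_pos.mpr (Real.sqrt_pos.mpr hqY)
  have hab : a ≤ b :=
    one_div_le_one_div_of_le (Real.sqrt_pos.mpr hqX) (Real.sqrt_le_sqrt hqXY)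
  have hasq : (A * Y ^ 2 + B * Y + C) * a ^ 2 = 1 := by
    rw [ha, div_pow, Real.sq_sqrt hqY.le, one_pow, mul_one_div_cancel hqY.ne']
  have hbsq : (A * X ^ 2 + B * X + C) * b ^ 2 = 1 := by
    rw [hb, div_pow, Real.sq_sqrt hqX.le, one_pow, mul_one_div_cancel hqX.ne']
  have hgcont : Continuous (hyperbolaBranch A B D) :=
    (lipschitzWith_hyperbolaBranch hA hD).continuous
  have hcont : Continuous fun y => max (min (Y * y) (hyperbolaBranch A B D y) - X * y) 0 := by
    fun_prop
  have h1 : ∫ y in (0 : ℝ)..a, max (min (Y * y) (hyperbolaBranch A B D y) - X * y) 0 =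
      (Y - X) * a ^ 2 / 2 := by
    have hcongr : ∫ y in (0 : ℝ)..a, max (min (Y * y) (hyperbolaBranch A B D y) - X * y) 0 =
        ∫ y in (0 : ℝ)..a, (Y - X) * y := by
      refine intervalIntegral.integral_congr fun y hy => ?_
      rw [Set.uIcc_of_le ha0.le] at hy
      rw [min_eq_left ((mul_le_hyperbolaBranch_iff hA hDdef hD hY hy.1).mpr hy.2), ← sub_mul,
        max_eq_left (mul_nonneg (sub_nonneg.mpr hXY) hy.1)]
    rw [hcongr, intervalIntegral.integral_const_mul, integral_id]
    ring
  have h2 : ∫ y in a..b, max (min (Y * y) (hyperbolaBranch A B D y) - X * y) 0 =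
      (-logQuotient A B D X / 2) -
        (Y * a ^ 2 / 2 - logQuotient A B D Y / 2 - X * a ^ 2 / 2) := by
    have hcongr : ∫ y in a..b, max (min (Y * y) (hyperbolaBranch A B D y) - X * y) 0 =
        ∫ y in a..b, (hyperbolaBranch A B D y - X * y) := by
      refine intervalIntegral.integral_congr fun y hy => ?_
      rw [Set.uIcc_of_le hab] at hy
      have hy0 := ha0.le.trans hy.1
      have hle : hyperbolaBranch A B D y ≤ Y * y := by
        rcases hy.1.eq_or_lt with h | h
        · rw [← h, hyperbolaBranch_eq_mul hA hDdef hY ha0.le hasq]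
        · exact (lt_of_not_ge fun h' =>
            h.not_ge ((mul_le_hyperbolaBranch_iff hA hDdef hD hY hy0).mp h')).le
      rw [min_eq_right hle, max_eq_left
        (sub_nonneg.mpr ((mul_le_hyperbolaBranch_iff hA hDdef hD hX hy0).mpr hy.2))]
    have hderiv : ∀ y ∈ Set.uIcc a b, HasDerivAt (fun y => y * hyperbolaBranch A B D y / 2 -
        logQuotient A B D (hyperbolaBranch A B D y / y) / 2 - X * (y ^ 2 / 2))
          (hyperbolaBranch A B D y - X * y) y := by
      intro y hy
      rw [Set.uIcc_of_le hab] at hy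
      have hsq : HasDerivAt (fun y : ℝ => X * (y ^ 2 / 2)) (X * y) y := by
        simpa using (((hasDerivAt_pow 2 y).div_const 2).const_mul X)
      exact (hasDerivAt_hyperbolaBranch_antiderivative hA hDdef hD (ha0.trans_le hy.1)).sub hsq
    rw [hcongr, intervalIntegral.integral_eq_sub_of_hasDerivAt hderiv
      ((hgcont.sub (by fun_prop)).intervalIntegrable _ _),
      hyperbolaBranch_eq_mul hA hDdef hY ha0.le hasq,
      hyperbolaBranch_eq_mul hA hDdef hX (ha0.le.trans hab) hbsq,
      mul_div_cancel_right₀ _ ha0.ne', mul_div_cancel_right₀ _ (ha0.trans_le hab).ne']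
    ring
  rw [← intervalIntegral.integral_add_adjacent_intervals (hcont.intervalIntegrable 0 a)
    (hcont.intervalIntegrable a b), h1, h2]
  ring

theorem mem_sector_iff (hA : 0 < A) (hDdef : D = B ^ 2 - 4 * A * C) (hD : 0 < D)
    {X Y : ℝ} (hX : (-B + √D) / (2 * A) < X) {x y : ℝ} :
    (x, y) ∈ regionBetweenGraphs (fun y => X * y)
        (fun y => min (Y * y) (hyperbolaBranch A B D y)) (1 / √(A * X ^ 2 + B * X + C)) ↔
      0 < y ∧ X ≤ x / y ∧ x / y ≤ Y ∧ 0 < A * x ^ 2 + B * x * y + C * y ^ 2 ∧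
        A * x ^ 2 + B * x * y + C * y ^ 2 ≤ 1 := by
  simp only [regionBetweenGraphs, Set.mem_ofPred_eq, le_min_iff]
  refine and_congr_right fun hy => ?_
  rw [le_div_iff₀ hy, div_le_iff₀ hy, ← mul_le_hyperbolaBranch_iff hA hDdef hD hX hy.le]
  have hlin := (Real.sqrt_nonneg D).trans (sqrt_lt_of_root_lt hA hX).le
  have hlinxy : X * y ≤ x → 0 ≤ 2 * A * x + B * y := fun h => by
    nlinarith [mul_nonneg hlin hy.le, mul_nonneg hA.le (sub_nonneg.mpr h)]
  constructor
  · rintro ⟨-, hx, hxY, hxg⟩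
    have hq := quadratic_pos_of_root_lt hA hDdef hD (hX.trans_le ((le_div_iff₀ hy).mpr hx))
    refine ⟨hx, hxY, ?_, (le_hyperbolaBranch_iff hA hDdef hD (hlinxy hx)).mp hxg⟩
    have heq : A * x ^ 2 + B * x * y + C * y ^ 2 =
        (A * (x / y) ^ 2 + B * (x / y) + C) * y ^ 2 := by field_simp
    rw [heq]
    positivity
  · rintro ⟨hx, hxY, -, hq⟩
    have hxg := (le_hyperbolaBranch_iff hA hDdef hD (hlinxy hx)).mpr hq
    exact ⟨hx.trans hxg, hx, hxY, hxg⟩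

theorem coprime_dilatedPoints_sector (hA : 0 < A) (hDdef : D = B ^ 2 - 4 * A * C) (hD : 0 < D)
    {X Y : ℝ} (hX : (-B + √D) / (2 * A) < X) {Δ : ℝ} (hΔ : 0 < Δ) :
    {p ∈ dilatedPoints (regionBetweenGraphs (fun y => X * y)
        (fun y => min (Y * y) (hyperbolaBranch A B D y)) (1 / √(A * X ^ 2 + B * X + C))) √Δ |
          Int.gcd p.1 p.2 = 1} =
      {p : ℤ × ℤ | 1 ≤ p.2 ∧ Int.gcd p.1 p.2 = 1 ∧
        X ≤ (p.1 : ℝ) / (p.2 : ℝ) ∧ (p.1 : ℝ) / (p.2 : ℝ) ≤ Y ∧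
        0 < A * (p.1 : ℝ) ^ 2 + B * (p.1 : ℝ) * (p.2 : ℝ) + C * (p.2 : ℝ) ^ 2 ∧
        A * (p.1 : ℝ) ^ 2 + B * (p.1 : ℝ) * (p.2 : ℝ) + C * (p.2 : ℝ) ^ 2 ≤ Δ} := by
  ext ⟨m, n⟩
  have hs : 0 < √Δ := Real.sqrt_pos.mpr hΔ
  have hform : A * ((m : ℝ) / √Δ) ^ 2 + B * ((m : ℝ) / √Δ) * ((n : ℝ) / √Δ) +
      C * ((n : ℝ) / √Δ) ^ 2 =
        (A * (m : ℝ) ^ 2 + B * (m : ℝ) * (n : ℝ) + C * (n : ℝ) ^ 2) / Δ := by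
    nth_rewrite 5 [← Real.sq_sqrt hΔ.le]
    field_simp
  have hn : 0 < (n : ℝ) / √Δ ↔ 1 ≤ n := by
    rw [div_pos_iff_of_pos_right hs, Int.cast_pos]
    omega
  simp only [Set.mem_ofPred_eq, dilatedPoints]
  rw [mem_sector_iff hA hDdef hD hX, hform, div_div_div_cancel_right₀ hs.ne', hn,
    div_pos_iff_of_pos_right hΔ, div_le_one hΔ]
  tauto

end Hyperbola

theorem sqrt_mul_one_add_log_ceil_le {K ε Δ : ℝ} (hK : 0 < K) (hε : 0 < ε) (hΔ : 1 ≤ Δ) :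
    √Δ * (1 + Real.log ⌈K * √Δ⌉₊) ≤
      (1 + Real.log (K + 1) + 1 / ε) * Δ ^ ((1 : ℝ) / 2 + ε) := by
  have hΔ0 : 0 < Δ := by linarith
  have hs : 1 ≤ √Δ := Real.one_le_sqrt.mpr hΔ
  have hsΔ : √Δ ≤ Δ := by nlinarith [Real.sq_sqrt hΔ0.le]
  have hceil : (⌈K * √Δ⌉₊ : ℝ) ≤ (K + 1) * Δ := by
    have h := (Nat.ceil_lt_add_one (by positivity : 0 ≤ K * √Δ)).le
    nlinarith [mul_le_mul_of_nonneg_left hsΔ hK.le]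
  have hpos : (0 : ℝ) < ⌈K * √Δ⌉₊ := by
    exact_mod_cast Nat.ceil_pos.mpr (by positivity)
  have hlog : Real.log ⌈K * √Δ⌉₊ ≤ Real.log (K + 1) + Δ ^ ε / ε := by
    refine (Real.log_le_log hpos hceil).trans ?_
    rw [Real.log_mul (by positivity) hΔ0.ne']
    linarith [Real.log_le_rpow_div hΔ0.le hε]
  have hone : 1 ≤ Δ ^ ε := Real.one_le_rpow hΔ hε.le
  have hlogK : 0 ≤ Real.log (K + 1) := Real.log_nonneg (by linarith)
  rw [Real.rpow_add hΔ0, ← Real.sqrt_eq_rpow]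
  calc √Δ * (1 + Real.log ⌈K * √Δ⌉₊)
      ≤ √Δ * ((1 + Real.log (K + 1)) * Δ ^ ε + 1 / ε * Δ ^ ε) := by
        refine mul_le_mul_of_nonneg_left ?_ (by positivity)
        rw [one_div_mul_eq_div]
        nlinarith
    _ = _ := by ring

/-- For `A > 0`, `D = B² - 4AC > 0`, and `[X,Y]` to the right of the larger root,
the number of coprime pairs `(m,n)`, `n ≥ 1`, with `X ≤ m/n ≤ Y` and
`0 < Am² + Bmn + Cn² ≤ Δ` is
`(3Δ/π²)(1/√D)[log((t - (-B+√D)/(2A))/(t - (-B-√D)/(2A)))]_{t=X}^{t=Y} + O(Δ^{1/2+ε})`. -/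
theorem equid_count_A_pos_D_pos (A B C X Y : ℝ) (hA : 0 < A)
    (hD : 0 < B ^ 2 - 4 * A * C)
    (hX : (-B + Real.sqrt (B ^ 2 - 4 * A * C)) / (2 * A) < X) (hXY : X ≤ Y)
    (ε : ℝ) (hε : 0 < ε) :
    ∃ c : ℝ, 0 < c ∧ ∃ Δ₀ : ℝ, ∀ Δ : ℝ, Δ₀ ≤ Δ →
      abs (({p : ℤ × ℤ | 1 ≤ p.2 ∧ Int.gcd p.1 p.2 = 1 ∧
            X ≤ (p.1 : ℝ) / (p.2 : ℝ) ∧ (p.1 : ℝ) / (p.2 : ℝ) ≤ Y ∧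
            0 < A * (p.1 : ℝ) ^ 2 + B * (p.1 : ℝ) * (p.2 : ℝ) + C * (p.2 : ℝ) ^ 2 ∧
            A * (p.1 : ℝ) ^ 2 + B * (p.1 : ℝ) * (p.2 : ℝ) + C * (p.2 : ℝ) ^ 2 ≤ Δ}.ncard : ℝ) -
          3 * Δ / π ^ 2 * (1 / Real.sqrt (B ^ 2 - 4 * A * C)) *
            (Real.log ((Y - (-B + Real.sqrt (B ^ 2 - 4 * A * C)) / (2 * A)) /
                (Y - (-B - Real.sqrt (B ^ 2 - 4 * A * C)) / (2 * A))) -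
              Real.log ((X - (-B + Real.sqrt (B ^ 2 - 4 * A * C)) / (2 * A)) /
                (X - (-B - Real.sqrt (B ^ 2 - 4 * A * C)) / (2 * A))))) ≤
        c * Δ ^ ((1 : ℝ) / 2 + ε) := by
  set D := B ^ 2 - 4 * A * C with hDdef
  set K := 1 / √(A * X ^ 2 + B * X + C) with hKdef
  have hK : 0 < K :=
    one_div_pos.mpr (Real.sqrt_pos.mpr (quadratic_pos_of_root_lt hA hDdef hD hX))
  obtain ⟨c, hc, hcount⟩ := abs_ncard_dilatedPoints_sub_le (lipschitzWith_smul X)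
    ((lipschitzWith_smul Y).min (lipschitzWith_hyperbolaBranch (B := B) hA hD)) hK.le
  simp only [smul_eq_mul] at hcount
  rw [integral_sector_length hA hDdef hD hX hXY] at hcount
  set κ := (logQuotient A B D Y - logQuotient A B D X) / 2 with hκ
  have hlogK : 0 ≤ Real.log (K + 1) := Real.log_nonneg (by linarith)
  refine ⟨c * (1 + Real.log (K + 1) + 1 / ε) + |κ| / K + 1, by positivity, 1, fun Δ hΔ => ?_⟩
  have hΔ0 : 0 < Δ := by linarith
  have hmain := abs_ncard_coprime_dilatedPoints_sub_le hK hc (fun p hp => ⟨hp.1, hp.2.1⟩)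
    (fun s hs => finite_dilatedPoints_regionBetweenGraphs _ _ hK.le hs) hcount
    (Real.sqrt_pos.mpr hΔ0)
  rw [hKdef, coprime_dilatedPoints_sector hA hDdef hD hX hΔ0, ← hKdef, Real.sq_sqrt hΔ0.le,
    show 6 / π ^ 2 * κ * Δ = 3 * Δ / π ^ 2 * (1 / √D) *
      (Real.log ((Y - (-B + √D) / (2 * A)) / (Y - (-B - √D) / (2 * A))) -
        Real.log ((X - (-B + √D) / (2 * A)) / (X - (-B - √D) / (2 * A)))) by
      rw [hκ, logQuotient, logQuotient]
      ring] at hmain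
  refine hmain.trans ?_
  have hlog := mul_le_mul_of_nonneg_left (sqrt_mul_one_add_log_ceil_le hK hε hΔ) hc
  have hpow : √Δ ≤ Δ ^ ((1 : ℝ) / 2 + ε) := by
    rw [Real.sqrt_eq_rpow]
    exact Real.rpow_le_rpow_of_exponent_le hΔ (by linarith)
  have hκpow := mul_le_mul_of_nonneg_left hpow (by positivity : 0 ≤ |κ| / K)
  have hnonneg : 0 ≤ Δ ^ ((1 : ℝ) / 2 + ε) := by positivity
  calc _ = c * (√Δ * (1 + Real.log ⌈K * √Δ⌉₊)) + |κ| / K * √Δ := by ring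
    _ ≤ _ := by linarith
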